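/- Let 𝒜 be an abelian category and let K^{i,j,•} for i, j ∈ {−1, 0, 1} be cochain complexes in 𝒜 together with chain maps forming a commutative 3×3 square of complexes, such that for each fixed j the sequence 0 → K^{−1,j,•} → K^{0,j,•} → K^{1,j,•} → 0 is a degreewise short exact sequence of complexes, and likewise for each fixed i the sequence 0 → K^{i,−1,•} → K^{i,0,•} → K^{i,1,•} → 0 is a degreewise short exact sequence of complexes. Assume H^{k−1}(K^{1,1,•}) = 0. Let ξ ∈ H^k(K^{0,0,•}) be a class whose image in H^k(K^{1,1,•}) vanishes, let ξ′ ∈ H^k(K^{−1,1,•}) be a class whose image in H^k(K^{0,1,•}) equals the image of ξ, and let ξ″ ∈ H^k(K^{1,−1,•}) be a class whose image in H^k(K^{1,0,•}) equals the image of ξ. Then the image of ξ′ under the connecting homomorphism H^k(K^{−1,1,•}) → H^{k+1}(K^{−1,−1,•}) attached to the short exact sequence 0 → K^{−1,−1,•} → K^{−1,0,•} → K^{−1,1,•} → 0 and the image of ξ″ under the connecting homomorphism H^k(K^{1,−1,•}) → H^{k+1}(K^{−1,−1,•}) attached to the short exact sequence 0 → K^{−1,−1,•} → K^{0,−1,•}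 → K^{1,−1,•} → 0 coincide up to sign (i.e., one is equal to plus or minus the other). -/

import Mathlib

open CategoryTheory HomologicalComplex

section

variable {C ι : Type*} [Category C] [Abelian C] {c : ComplexShape ι}

/-- For a short exact sequence of complexes `0 ⟶ X₁ ⟶ X₂ ⟶ X₃ ⟶ 0`, the map
`X₁.opcycles j ⟶ X₂.opcycles j` is a monomorphism if the homology of `X₃` in the preceding degree
vanishes. -/
lemma CategoryTheory.ShortComplex.ShortExact.mono_opcyclesMap_f
    {S : ShortComplex (HomologicalComplex C c)} (hS : S.ShortExact) {i j : ι} (hij : c.Rel i j)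
    (hi : Limits.IsZero (S.X₃.homology i)) : Mono (HomologicalComplex.opcyclesMap S.f j) := by
  have := hS.mono_f
  have := hS.epi_g
  have hex : S.X₃.ExactAt i := (S.X₃.exactAt_iff_isZero_homology i).2 hi
  rw [S.X₃.exactAt_iff_exact_up_to_refinements _ i j rfl (c.next_eq' hij)] at hex
  rw [Preadditive.mono_iff_cancel_zero]
  intro A y hy
  obtain ⟨A₁, π₁, _, x, hx⟩ := surjective_up_to_refinements_of_epi (S.X₁.pOpcycles j) y
  have hx₀ : (x ≫ S.f.f j) ≫ S.X₂.pOpcycles j = 0 := by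
    rw [Category.assoc, ← HomologicalComplex.p_opcyclesMap, ← reassoc_of% hx, hy, Limits.comp_zero]
  obtain ⟨A₂, π₂, _, b, hb⟩ :=
    (S.X₂.comp_pOpcycles_eq_zero_iff_up_to_refinements _ i (c.prev_eq' hij)).1 hx₀
  obtain ⟨A₃, π₃, _, e, he⟩ := hex (b ≫ S.g.f i) (by
    rw [Category.assoc, S.g.comm, ← reassoc_of% hb, ← HomologicalComplex.comp_f, S.zero]
    simp)
  obtain ⟨A₄, π₄, _, e', he'⟩ := surjective_up_to_refinements_of_epi (S.g.f (c.prev i)) e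
  have hb₀ : (π₄ ≫ π₃ ≫ b - e' ≫ S.X₂.d _ i) ≫ S.g.f i = 0 := by
    simp only [Preadditive.sub_comp, Category.assoc, he, ← S.g.comm, ← reassoc_of% he', sub_self]
  obtain ⟨A₅, π₅, _, w, hw⟩ : ∃ (A₅ : C) (π₅ : A₅ ⟶ A₄) (_ : Epi π₅) (w : A₅ ⟶ S.X₁.X i),
      π₅ ≫ (π₄ ≫ π₃ ≫ b - e' ≫ S.X₂.d _ i) = w ≫ S.f.f i :=
    (hS.exact.map (HomologicalComplex.eval C c i)).exact_up_to_refinements _ hb₀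
  have hwx : π₅ ≫ π₄ ≫ π₃ ≫ π₂ ≫ x = w ≫ S.X₁.d i j := by
    rw [← cancel_mono (S.f.f j), Category.assoc w, ← S.f.comm, ← reassoc_of% hw]
    simp [hb]
  rw [← cancel_epi π₁, ← cancel_epi π₂, ← cancel_epi π₃, ← cancel_epi π₄, ← cancel_epi π₅, hx,
    reassoc_of% hwx]
  simp

end

open CategoryTheory HomologicalComplex

/-- Lemma 2.8: in a 3×3 commutative square of short exact sequences of cochain
complexes in an abelian category, with `H^{k-1}` of the top-right corner zero,
the two connecting homomorphisms applied to compatible classes agree up to sign.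
Classes in homology objects are expressed as generalized elements (morphisms
from an arbitrary object `T`). -/
theorem stmt_0 {C : Type*} [Category C] [Abelian C]
    (K₀₀ K₁₀ K₂₀ K₀₁ K₁₁ K₂₁ K₀₂ K₁₂ K₂₂ : CochainComplex C ℤ)
    -- horizontal maps (index `i` increasing), one row for each `j ∈ {-1,0,1}`
    (f₀ : K₀₀ ⟶ K₁₀) (g₀ : K₁₀ ⟶ K₂₀)
    (f₁ : K₀₁ ⟶ K₁₁) (g₁ : K₁₁ ⟶ K₂₁)
    (f₂ : K₀₂ ⟶ K₁₂) (g₂ : K₁₂ ⟶ K₂₂)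
    -- vertical maps (index `j` increasing), one column for each `i ∈ {-1,0,1}`
    (u₀ : K₀₀ ⟶ K₀₁) (v₀ : K₀₁ ⟶ K₀₂)
    (u₁ : K₁₀ ⟶ K₁₁) (v₁ : K₁₁ ⟶ K₁₂)
    (u₂ : K₂₀ ⟶ K₂₁) (v₂ : K₂₁ ⟶ K₂₂)
    -- commutativity of the 3×3 square
    (sq₁ : f₀ ≫ u₁ = u₀ ≫ f₁) (sq₂ : g₀ ≫ u₂ = u₁ ≫ g₁)
    (sq₃ : f₁ ≫ v₁ = v₀ ≫ f₂) (sq₄ : g₁ ≫ v₂ = v₁ ≫ g₂)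
    -- the rows and columns are short exact sequences of complexes
    (wr₀ : f₀ ≫ g₀ = 0) (wr₁ : f₁ ≫ g₁ = 0) (wr₂ : f₂ ≫ g₂ = 0)
    (wc₀ : u₀ ≫ v₀ = 0) (wc₁ : u₁ ≫ v₁ = 0) (wc₂ : u₂ ≫ v₂ = 0)
    (hr₀ : (ShortComplex.mk f₀ g₀ wr₀).ShortExact)
    (hr₁ : (ShortComplex.mk f₁ g₁ wr₁).ShortExact)
    (hr₂ : (ShortComplex.mk f₂ g₂ wr₂).ShortExact)
    (hc₀ : (ShortComplex.mk u₀ v₀ wc₀).ShortExact)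
    (hc₁ : (ShortComplex.mk u₁ v₁ wc₁).ShortExact)
    (hc₂ : (ShortComplex.mk u₂ v₂ wc₂).ShortExact)
    (k : ℤ)
    -- `H^{k-1}(K^{1,1,•}) = 0`
    (hK : Limits.IsZero (K₂₂.homology (k - 1)))
    (T : C)
    -- `ξ ∈ H^k(K^{0,0,•})`, `ξ' ∈ H^k(K^{-1,1,•})`, `ξ'' ∈ H^k(K^{1,-1,•})`
    (ξ : T ⟶ K₁₁.homology k)
    (ξ' : T ⟶ K₀₂.homology k) (ξ'' : T ⟶ K₂₀.homology k)
    -- the image of `ξ` in `H^k(K^{1,1,•})` vanishes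
    (hξ : ξ ≫ homologyMap (g₁ ≫ v₂) k = 0)
    -- the images of `ξ'` and `ξ` in `H^k(K^{0,1,•})` coincide
    (hξ' : ξ' ≫ homologyMap f₂ k = ξ ≫ homologyMap v₁ k)
    -- the images of `ξ''` and `ξ` in `H^k(K^{1,0,•})` coincide
    (hξ'' : ξ'' ≫ homologyMap u₂ k = ξ ≫ homologyMap g₁ k) :
    ξ' ≫ hc₀.δ k (k + 1) rfl = ξ'' ≫ hr₀.δ k (k + 1) rfl ∨
      ξ' ≫ hc₀.δ k (k + 1) rfl = -(ξ'' ≫ hr₀.δ k (k + 1) rfl) := by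
  have : Mono (opcyclesMap u₂ k) := hc₂.mono_opcyclesMap_f (i := k - 1) (by simp) hK
  have := hc₀.mono_f
  have := hr₁.mono_f
  have := hc₀.epi_g
  dsimp only at *
  have hξ'ι : (ξ' ≫ K₀₂.homologyι k) ≫ opcyclesMap f₂ k =
      (ξ ≫ K₁₁.homologyι k) ≫ opcyclesMap v₁ k := by
    simp only [Category.assoc, ← homologyι_naturality, reassoc_of% hξ']
  have hξ''ι : (ξ'' ≫ K₂₀.homologyι k) ≫ opcyclesMap u₂ k =
      (ξ ≫ K₁₁.homologyι k) ≫ opcyclesMap g₁ k := by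
    simp only [Category.assoc, ← homologyι_naturality, reassoc_of% hξ'']
  obtain ⟨A₁, π₁, _, n, hn⟩ :=
    surjective_up_to_refinements_of_epi (opcyclesMap v₀ k) (ξ' ≫ K₀₂.homologyι k)
  have := hc₁.epi_g
  obtain ⟨A₂, π₂, _, p, hp⟩ :=
    (opcycles_right_exact _ hc₁.exact k).exact_up_to_refinements
      (π₁ ≫ ξ ≫ K₁₁.homologyι k - n ≫ opcyclesMap f₁ k) (by
        dsimp
        rw [Preadditive.sub_comp, Category.assoc, ← hξ'ι, Category.assoc, Category.assoc, ← opcyclesMap_comp, sq₃,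
          opcyclesMap_comp, reassoc_of% hn, sub_self])
  dsimp at p hp
  have hpg : p ≫ opcyclesMap g₀ k = π₂ ≫ π₁ ≫ ξ'' ≫ K₂₀.homologyι k := by
    rw [← cancel_mono (opcyclesMap u₂ k)]
    simp only [Category.assoc] at hξ''ι ⊢
    rw [hξ''ι, ← opcyclesMap_comp, sq₂, opcyclesMap_comp, ← reassoc_of% hp]
    simp [← opcyclesMap_comp, wr₁]
  obtain ⟨z', hz'⟩ : ∃ z' : A₁ ⟶ K₀₀.cycles (k + 1),
      z' ≫ cyclesMap u₀ (k + 1) = n ≫ K₀₁.opcyclesToCycles k (k + 1) :=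
    (cycles_left_exact _ hc₀.exact (k + 1)).lift' (n ≫ K₀₁.opcyclesToCycles k (k + 1)) (by
      dsimp
      rw [Category.assoc, ← opcyclesToCycles_naturality, ← reassoc_of% hn]
      simp)
  have := hr₀.mono_f
  obtain ⟨z'', hz''⟩ : ∃ z'' : A₂ ⟶ K₀₀.cycles (k + 1),
      z'' ≫ cyclesMap f₀ (k + 1) = p ≫ K₁₀.opcyclesToCycles k (k + 1) :=
    (cycles_left_exact _ hr₀.exact (k + 1)).lift' (p ≫ K₁₀.opcyclesToCycles k (k + 1)) (by
      dsimp
      rw [Category.assoc, ← opcyclesToCycles_naturality, reassoc_of% hpg]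
      simp)
  have hδ' := hc₀.δ_eq' k (k + 1) rfl (π₁ ≫ ξ') n z' (by simpa using hn.symm) hz'
  have hδ'' := hr₀.δ_eq' k (k + 1) rfl (π₂ ≫ π₁ ≫ ξ'') p z'' (by simpa using hpg) hz''
  have hz : π₂ ≫ z' = -z'' := by
    rw [← cancel_mono (cyclesMap u₀ (k + 1)), ← cancel_mono (cyclesMap f₁ (k + 1))]
    have h₁ : z'' ≫ cyclesMap u₀ (k + 1) ≫ cyclesMap f₁ (k + 1) =
        p ≫ opcyclesMap u₁ k ≫ K₁₁.opcyclesToCycles k (k + 1) := by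
      rw [← cyclesMap_comp, ← sq₁, cyclesMap_comp, reassoc_of% hz'', opcyclesToCycles_naturality]
    simp only [Category.assoc, Preadditive.neg_comp, h₁, reassoc_of% hz', ← reassoc_of% hp]
    simp
  right
  rw [← cancel_epi π₁, ← cancel_epi π₂]
  simp only [Category.assoc] at hδ' hδ''
  simp only [Preadditive.comp_neg, hδ', hδ'', reassoc_of% hz, Preadditive.neg_comp]
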